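/- Let Γ = (G, I, O, λ) be a labelled open graph and u ∈ V∖O a vertex with λ(u) ∈ {XZ, YZ, Z}, and let Γ' = (G∖{u}, I, O, λ restricted to (V∖{u})∖O) be obtained by deleting u from the graph. If (p, ≺) is a Pauli flow for Γ, then (p', ≺) is a Pauli flow for Γ', where for every v ∈ (V∖O)∖{u}, p'(v) := p(v) Δ p(u) if u ∈ p(v), and p'(v) := p(v) if u ∉ p(v). Moreover, if (p, ≺) is focussed then so is (p', ≺), and every focussed set for Γ is also a focussed set for Γ'. -/

import Mathlib

open scoped symmDiff

inductive MeasLabel : Type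
  | XY | XZ | YZ | X | Y | Z
deriving DecidableEq

/-- A labelled open graph: a finite simple graph with input and output sets and a
measurement labelling (only its values on non-outputs are ever used). -/
structure LOG (V : Type) [Fintype V] where
  G : SimpleGraph V
  I : Set V
  O : Set V
  lam : V → MeasLabel

namespace LOG

variable {V : Type} [Fintype V]

/-- The odd neighbourhood of `A`: vertices with an odd number of neighbours in `A`. -/
def odd (G : SimpleGraph V) (A : Set V) : Set V :=
  {w | Odd ((G.neighborSet w ∩ A).ncard)}

/-- `v` is a measured (non-output) vertex whose label lies in `s`.  (The labelling of a
labelled open graph is only defined on non-outputs.) -/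
def labIn (Γ : LOG V) (v : V) (s : Set MeasLabel) : Prop :=
  v ∉ Γ.O ∧ Γ.lam v ∈ s

/-- The Pauli flow conditions for a map `p` and a strict partial order `prec` (`≺`). -/
structure IsPauliFlow (Γ : LOG V) (p : V → Set V) (prec : V → V → Prop) : Prop where
  irrefl : ∀ a, ¬ prec a a
  trans : ∀ a b c, prec a b → prec b c → prec a c
  psub : ∀ u, u ∉ Γ.O → ∀ v ∈ p u, v ∉ Γ.I
  pf1 : ∀ u, u ∉ Γ.O → ∀ v ∈ p u, u ≠ v →
    ¬ Γ.labIn v {MeasLabel.X, MeasLabel.Y} → prec u v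
  pf2 : ∀ u, u ∉ Γ.O → ∀ v ∈ odd Γ.G (p u), u ≠ v →
    ¬ Γ.labIn v {MeasLabel.Y, MeasLabel.Z} → prec u v
  pf3 : ∀ u, u ∉ Γ.O → ∀ v, ¬ prec u v → u ≠ v →
    Γ.labIn v {MeasLabel.Y} → (v ∈ p u ↔ v ∈ odd Γ.G (p u))
  pf4 : ∀ u, u ∉ Γ.O → Γ.lam u = MeasLabel.XY → u ∉ p u ∧ u ∈ odd Γ.G (p u)
  pf5 : ∀ u, u ∉ Γ.O → Γ.lam u = MeasLabel.XZ → u ∈ p u ∧ u ∈ odd Γ.G (p u)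
  pf6 : ∀ u, u ∉ Γ.O → Γ.lam u = MeasLabel.YZ → u ∈ p u ∧ u ∉ odd Γ.G (p u)
  pf7 : ∀ u, u ∉ Γ.O → Γ.lam u = MeasLabel.X → u ∈ odd Γ.G (p u)
  pf8 : ∀ u, u ∉ Γ.O → Γ.lam u = MeasLabel.Z → u ∈ p u
  pf9 : ∀ u, u ∉ Γ.O → Γ.lam u = MeasLabel.Y →
    ((u ∈ p u ∧ u ∉ odd Γ.G (p u)) ∨ (u ∉ p u ∧ u ∈ odd Γ.G (p u)))

/-- `phat` is focussed over `S`. -/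
def FocussedOver (Γ : LOG V) (phat S : Set V) : Prop :=
  (∀ w ∈ S ∩ phat, Γ.lam w ∈ ({MeasLabel.XY, MeasLabel.X, MeasLabel.Y} : Set MeasLabel)) ∧
  (∀ w ∈ S ∩ odd Γ.G phat,
    Γ.lam w ∈ ({MeasLabel.XZ, MeasLabel.YZ, MeasLabel.Y, MeasLabel.Z} : Set MeasLabel)) ∧
  (∀ w ∈ S, Γ.lam w = MeasLabel.Y → (w ∈ phat ↔ w ∈ odd Γ.G phat))

/-- A focussed set for `Γ`: a subset of the non-inputs that is focussed over all
non-outputs. -/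
def IsFocussedSet (Γ : LOG V) (phat : Set V) : Prop :=
  (∀ v ∈ phat, v ∉ Γ.I) ∧ FocussedOver Γ phat {v | v ∉ Γ.O}

/-- A Pauli flow map `p` is focussed if each `p v` is focussed over the measured
vertices other than `v`. -/
def IsFocussed (Γ : LOG V) (p : V → Set V) : Prop :=
  ∀ v, v ∉ Γ.O → FocussedOver Γ (p v) ({w | w ∉ Γ.O} \ {v})

/-- `Vcum prec k` is `V_{∪k}^≺`, the union of the layers up to depth `k`. -/
def Vcum (prec : V → V → Prop) : ℕ → Set V
  | 0 => {v | ∀ w, ¬ prec v w}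
  | k + 1 => Vcum prec k ∪ {v | v ∉ Vcum prec k ∧ ∀ w, w ∉ Vcum prec k → ¬ prec v w}

/-- `Vlayer prec k` is `V_k^≺`, the `≺`-maximal elements among the vertices not of
smaller depth. -/
def Vlayer (prec : V → V → Prop) : ℕ → Set V
  | 0 => {v | ∀ w, ¬ prec v w}
  | k + 1 => {v | v ∉ Vcum prec k ∧ ∀ w, w ∉ Vcum prec k → ¬ prec v w}

/-- `prec` is more delayed than `prec'`. -/
def MoreDelayed (prec prec' : V → V → Prop) : Prop :=
  (∀ k, (Vcum prec' k).ncard ≤ (Vcum prec k).ncard) ∧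
  ∃ k, (Vcum prec' k).ncard < (Vcum prec k).ncard

/-- A maximally delayed Pauli flow: no Pauli flow for the same labelled open graph is
more delayed. -/
def IsMaxDelayed (Γ : LOG V) (p : V → Set V) (prec : V → V → Prop) : Prop :=
  IsPauliFlow Γ p prec ∧
  ∀ q prec', IsPauliFlow Γ q prec' → ¬ MoreDelayed prec' prec

/-- `Λ_u^P`: the measured vertices other than `u` whose label is `P`. -/
def LamP (Γ : LOG V) (u : V) (P : MeasLabel) : Set V :=
  {v | v ∉ Γ.O ∧ v ≠ u ∧ Γ.lam v = P}

/-- `V_{k+1}^{≺,XY}` where `A = V_{∪k}^≺`. -/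
def VXY (Γ : LOG V) (A : Set V) : Set V :=
  {u | u ∉ Γ.O ∧ Γ.lam u ∈ ({MeasLabel.XY, MeasLabel.X, MeasLabel.Y} : Set MeasLabel) ∧
    ∃ K, K ⊆ (A ∪ LamP Γ u MeasLabel.X ∪ LamP Γ u MeasLabel.Y) ∩ {v | v ∉ Γ.I} ∧
      (K ∩ LamP Γ u MeasLabel.Y) \ A = (odd Γ.G K ∩ LamP Γ u MeasLabel.Y) \ A ∧
      odd Γ.G K \ (A ∪ LamP Γ u MeasLabel.Y ∪ LamP Γ u MeasLabel.Z) = {u}}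

/-- `V_{k+1}^{≺,XZ}` where `A = V_{∪k}^≺`. -/
def VXZ (Γ : LOG V) (A : Set V) : Set V :=
  {u | u ∉ Γ.O ∧ Γ.lam u ∈ ({MeasLabel.XZ, MeasLabel.X, MeasLabel.Z} : Set MeasLabel) ∧
    ∃ K, K ⊆ (A ∪ LamP Γ u MeasLabel.X ∪ LamP Γ u MeasLabel.Y) ∩ {v | v ∉ Γ.I} ∧
      (K ∩ LamP Γ u MeasLabel.Y) \ A = (odd Γ.G (K ∪ {u}) ∩ LamP Γ u MeasLabel.Y) \ A ∧
      odd Γ.G (K ∪ {u}) \ (A ∪ LamP Γ u MeasLabel.Y ∪ LamP Γ u MeasLabel.Z) = {u}}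

/-- `V_{k+1}^{≺,YZ}` where `A = V_{∪k}^≺`. -/
def VYZ (Γ : LOG V) (A : Set V) : Set V :=
  {u | u ∉ Γ.O ∧ Γ.lam u ∈ ({MeasLabel.YZ, MeasLabel.Y, MeasLabel.Z} : Set MeasLabel) ∧
    ∃ K, K ⊆ (A ∪ LamP Γ u MeasLabel.X ∪ LamP Γ u MeasLabel.Y) ∩ {v | v ∉ Γ.I} ∧
      (K ∩ LamP Γ u MeasLabel.Y) \ A = (odd Γ.G (K ∪ {u}) ∩ LamP Γ u MeasLabel.Y) \ A ∧
      odd Γ.G (K ∪ {u}) \ (A ∪ LamP Γ u MeasLabel.Y ∪ LamP Γ u MeasLabel.Z) = ∅}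

end LOG


/-- The graph obtained by deleting the vertex `u` (the induced subgraph on `V ∖ {u}`). -/
def delGraph {V : Type} (G : SimpleGraph V) (u : V) : SimpleGraph {x : V // x ≠ u} :=
  SimpleGraph.comap (fun x => (x : V)) G

/-- The labelled open graph obtained by deleting the non-output vertex `u`. -/
def delVertex {V : Type} [Fintype V] [DecidableEq V] (Γ : LOG V) (u : V) :
    LOG {x : V // x ≠ u} where
  G := delGraph Γ.G u
  I := {x | (x : V) ∈ Γ.I}
  O := {x | (x : V) ∈ Γ.O}
  lam := fun x => Γ.lam x

theorem odd_symmDiff_iff {V : Type} [Fintype V] (G : SimpleGraph V) (A B : Set V) (w : V) :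
    w ∈ LOG.odd G (A ∆ B) ↔ ¬ (w ∈ LOG.odd G A ↔ w ∈ LOG.odd G B) := by
  classical
  have e : G.neighborSet w ∩ (A ∆ B) = (G.neighborSet w ∩ A) ∆ (G.neighborSet w ∩ B) := by
    ext x; simp only [Set.mem_inter_iff, Set.mem_symmDiff]; tauto
  simp only [LOG.odd, Set.mem_ofPred_eq, e]
  generalize G.neighborSet w ∩ A = S
  generalize G.neighborSet w ∩ B = T
  have h1 : (S ∆ T).ncard = (S \ T).ncard + (T \ S).ncard := by
    rw [Set.symmDiff_def]
    apply Set.ncard_union_eq _ (Set.toFinite _) (Set.toFinite _)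
    rw [Set.disjoint_left]
    intro x hx hy
    exact hx.2 hy.1
  have h2 := Set.ncard_inter_add_ncard_sdiff_eq_ncard S T (Set.toFinite _)
  have h3 := Set.ncard_inter_add_ncard_sdiff_eq_ncard T S (Set.toFinite _)
  rw [Set.inter_comm] at h3
  simp only [Nat.odd_iff]
  omega

theorem odd_del_iff {V : Type} [Fintype V] [DecidableEq V] (G : SimpleGraph V) (u : V)
    (A : Set V) (hA : u ∉ A) (A' : Set {x : V // x ≠ u}) (h : ∀ w, w ∈ A' ↔ (w : V) ∈ A)
    (w : {x : V // x ≠ u}) :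
    w ∈ LOG.odd (delGraph G u) A' ↔ (w : V) ∈ LOG.odd G A := by
  have e : G.neighborSet w ∩ A =
      Subtype.val '' ((delGraph G u).neighborSet w ∩ A') := by
    ext x
    simp only [Set.mem_inter_iff, SimpleGraph.mem_neighborSet, Set.mem_image, h, delGraph,
      SimpleGraph.comap_adj]
    constructor
    · rintro ⟨h1, h2⟩
      exact ⟨⟨x, fun hx => hA (hx ▸ h2)⟩, ⟨h1, h2⟩, rfl⟩
    · rintro ⟨y, hy, rfl⟩
      exact hy
  simp only [LOG.odd, Set.mem_ofPred_eq, e,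
    Set.ncard_image_of_injective _ Subtype.val_injective]

set_option maxHeartbeats 1000000 in
open LOG in
/-- deleting a vertex labelled `XZ`, `YZ` or `Z` preserves Pauli flows
(with the stated update of correction sets), focussedness, and focussed sets. -/
theorem delVertex_pauliFlow {V : Type} [Fintype V] [DecidableEq V] (Γ : LOG V)
    (u : V) (hu : u ∉ Γ.O)
    (hlam : Γ.lam u ∈ ({MeasLabel.XZ, MeasLabel.YZ, MeasLabel.Z} : Set MeasLabel))
    (p : V → Set V) (prec : V → V → Prop) (hpf : IsPauliFlow Γ p prec)
    (p' : {x : V // x ≠ u} → Set {x : V // x ≠ u})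
    (hp'1 : ∀ v : {x : V // x ≠ u}, (v : V) ∉ Γ.O → u ∈ p v.1 →
      ∀ w : {x : V // x ≠ u}, w ∈ p' v ↔ (w : V) ∈ p v.1 ∆ p u)
    (hp'2 : ∀ v : {x : V // x ≠ u}, (v : V) ∉ Γ.O → u ∉ p v.1 →
      ∀ w : {x : V // x ≠ u}, w ∈ p' v ↔ (w : V) ∈ p v.1)
    (prec' : {x : V // x ≠ u} → {x : V // x ≠ u} → Prop)
    (hprec' : ∀ a b : {x : V // x ≠ u}, prec' a b ↔ prec a.1 b.1) :
    IsPauliFlow (delVertex Γ u) p' prec' ∧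
      (IsFocussed Γ p → IsFocussed (delVertex Γ u) p') ∧
      (∀ phat : Set V, IsFocussedSet Γ phat →
        IsFocussedSet (delVertex Γ u) {w : {x : V // x ≠ u} | (w : V) ∈ phat}) := by
  have hup : u ∈ p u := by
    simp only [Set.mem_insert_iff, Set.mem_singleton_iff] at hlam
    rcases hlam with h | h | h
    · exact (hpf.pf5 u hu h).1
    · exact (hpf.pf6 u hu h).1
    · exact hpf.pf8 u hu h
  have hnXY : ¬ Γ.labIn u {MeasLabel.X, MeasLabel.Y} := by
    rintro ⟨_, h⟩
    simp only [Set.mem_insert_iff, Set.mem_singleton_iff] at hlam h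
    rcases hlam with h' | h' | h' <;> rw [h'] at h <;> simp at h
  have key : ∀ v : {x : V // x ≠ u}, (v : V) ∉ Γ.O →
      (∀ w : {x : V // x ≠ u}, (w ∈ p' v ↔ (w : V) ∈ p v) ∧
        (w ∈ odd (delGraph Γ.G u) (p' v) ↔ (w : V) ∈ odd Γ.G (p v))) ∨
      (prec v u ∧ ∀ w : {x : V // x ≠ u}, (w ∈ p' v ↔ ¬ ((w : V) ∈ p v ↔ (w : V) ∈ p u)) ∧
        (w ∈ odd (delGraph Γ.G u) (p' v) ↔
          ¬ ((w : V) ∈ odd Γ.G (p v) ↔ (w : V) ∈ odd Γ.G (p u)))) := by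
    intro v hv
    by_cases huv : u ∈ p v
    · right
      refine ⟨hpf.pf1 v hv u huv v.2 hnXY, fun w => ⟨?_, ?_⟩⟩
      · rw [hp'1 v hv huv w, Set.mem_symmDiff]; tauto
      · rw [odd_del_iff Γ.G u (p v ∆ p u) _ (p' v) (hp'1 v hv huv) w, odd_symmDiff_iff]
        rw [Set.mem_symmDiff]; tauto
    · left
      exact fun w => ⟨hp'2 v hv huv w,
        odd_del_iff Γ.G u (p v) huv (p' v) (hp'2 v hv huv) w⟩
  have hno : ∀ v : V, prec v u → ¬ prec u v := fun v h h' =>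
    hpf.irrefl _ (hpf.trans _ _ _ h h')
  have hn1 : ∀ v : V, v ≠ u → v ∉ Γ.O → prec v u → Γ.lam v ≠ .X → Γ.lam v ≠ .Y →
      v ∉ p u := by
    intro v hvu hv h h1 h2 hm
    refine hno v h (hpf.pf1 u hu v hm hvu.symm ?_)
    rintro ⟨_, h'⟩
    simp only [Set.mem_insert_iff, Set.mem_singleton_iff] at h'
    tauto
  have hn2 : ∀ v : V, v ≠ u → v ∉ Γ.O → prec v u → Γ.lam v ≠ .Y → Γ.lam v ≠ .Z →
      v ∉ odd Γ.G (p u) := by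
    intro v hvu hv h h1 h2 hm
    refine hno v h (hpf.pf2 u hu v hm hvu.symm ?_)
    rintro ⟨_, h'⟩
    simp only [Set.mem_insert_iff, Set.mem_singleton_iff] at h'
    tauto
  have hO : ∀ v : {x : V // x ≠ u}, v ∈ (delVertex Γ u).O ↔ (v : V) ∈ Γ.O := fun _ => Iff.rfl
  have hL : ∀ v : {x : V // x ≠ u}, (delVertex Γ u).lam v = Γ.lam v := fun _ => rfl
  have hG : (delVertex Γ u).G = delGraph Γ.G u := rfl
  have hlab : ∀ (v : {x : V // x ≠ u}) s, (delVertex Γ u).labIn v s ↔ Γ.labIn v s :=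
    fun _ _ => Iff.rfl
  have hne : ∀ {a b : {x : V // x ≠ u}}, a ≠ b → (a : V) ≠ b := fun h h' => h (Subtype.ext h')
  refine ⟨?_, ?_, ?_⟩
  · constructor
    · intro a h
      exact hpf.irrefl _ ((hprec' _ _).1 h)
    · intro a b c h h'
      exact (hprec' _ _).2 (hpf.trans _ _ _ ((hprec' _ _).1 h) ((hprec' _ _).1 h'))
    · intro v hv w hw hI
      have hI' : (w : V) ∈ Γ.I := hI
      have a1 := hpf.psub v hv w
      have a2 := hpf.psub u hu w
      rcases key v hv with k | ⟨_, k⟩ <;> have := (k w).1 <;> tauto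
    · intro v hv w hw hvw hl
      rw [hprec']
      rw [hlab] at hl
      have a1 := hpf.pf1 v hv w
      have a2 := hpf.pf1 u hu w
      have a3 := hne hvw
      have a4 := w.2.symm
      rcases key v hv with k | ⟨h, k⟩
      · have := (k w).1; tauto
      · have := (k w).1
        have := hpf.trans _ _ w h
        tauto
    · intro v hv w hw hvw hl
      rw [hprec']
      rw [hlab] at hl
      rw [hG] at hw
      have a1 := hpf.pf2 v hv w
      have a2 := hpf.pf2 u hu w
      have a3 := hne hvw
      have a4 := w.2.symm
      rcases key v hv with k | ⟨h, k⟩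
      · have := (k w).2; tauto
      · have := (k w).2
        have := hpf.trans _ _ w h
        tauto
    · intro v hv w hp hvw hl
      rw [hprec'] at hp
      rw [hlab] at hl
      rw [hG]
      have a1 := hpf.pf3 v hv w hp (hne hvw) hl
      rcases key v hv with k | ⟨h, k⟩
      · rw [(k w).1, (k w).2, a1]
      · have a2 := hpf.pf3 u hu w (fun h' => hp (hpf.trans _ _ w h h')) w.2.symm hl
        rw [(k w).1, (k w).2, a1, a2]
    all_goals
      intro v hv hl
      rw [hL] at hl
      rw [hO] at hv
      try rw [hG]
      have b1 := hn1 v v.2 hv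
      have b2 := hn2 v v.2 hv
    · have a1 := hpf.pf4 v hv hl
      rcases key v hv with k | ⟨h, k⟩ <;> rw [(k v).1, (k v).2]
      · exact a1
      · simp only [hl, h] at b1 b2; grind
    · have a1 := hpf.pf5 v hv hl
      rcases key v hv with k | ⟨h, k⟩ <;> rw [(k v).1, (k v).2]
      · exact a1
      · simp only [hl, h] at b1 b2; grind
    · have a1 := hpf.pf6 v hv hl
      rcases key v hv with k | ⟨h, k⟩ <;> rw [(k v).1, (k v).2]
      · exact a1
      · simp only [hl, h] at b1 b2; grind
    · have a1 := hpf.pf7 v hv hl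
      rcases key v hv with k | ⟨h, k⟩ <;> rw [(k v).2]
      · exact a1
      · simp only [hl, h] at b1 b2; grind
    · have a1 := hpf.pf8 v hv hl
      rcases key v hv with k | ⟨h, k⟩ <;> rw [(k v).1]
      · exact a1
      · simp only [hl, h] at b1 b2; grind
    · have a1 := hpf.pf9 v hv hl
      rcases key v hv with k | ⟨h, k⟩ <;> rw [(k v).1, (k v).2]
      · exact a1
      · have a2 := hpf.pf3 u hu v (hno v h) v.2.symm ⟨hv, hl⟩
        tauto
  · intro hf v hv
    obtain ⟨f1, f2, f3⟩ := hf v hv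
    obtain ⟨g1, g2, g3⟩ := hf u hu
    have hS : ∀ w : {x : V // x ≠ u}, w ∈ ({w | w ∉ (delVertex Γ u).O} \ {v} : Set _) →
        (w : V) ∈ ({w | w ∉ Γ.O} \ {(v : V)} : Set V) ∧
        (w : V) ∈ ({w | w ∉ Γ.O} \ {u} : Set V) :=
      fun w hw => ⟨⟨hw.1, hne hw.2⟩, ⟨hw.1, w.2⟩⟩
    refine ⟨?_, ?_, ?_⟩
    · rintro w ⟨hw, hm⟩
      obtain ⟨s1, s2⟩ := hS w hw
      rw [hL]
      have c1 := fun h => f1 w ⟨s1, h⟩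
      have c2 := fun h => g1 w ⟨s2, h⟩
      by_contra hc
      rcases key v hv with k | ⟨h, k⟩
      · exact hc (c1 ((k w).1.1 hm))
      · exact (k w).1.1 hm (iff_of_false (fun h => hc (c1 h)) (fun h => hc (c2 h)))
    · rintro w ⟨hw, hm⟩
      obtain ⟨s1, s2⟩ := hS w hw
      rw [hL]
      rw [hG] at hm
      have c1 := fun h => f2 w ⟨s1, h⟩
      have c2 := fun h => g2 w ⟨s2, h⟩
      by_contra hc
      rcases key v hv with k | ⟨h, k⟩
      · exact hc (c1 ((k w).2.1 hm))
      · exact (k w).2.1 hm (iff_of_false (fun h => hc (c1 h)) (fun h => hc (c2 h)))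
    · intro w hw hl
      obtain ⟨s1, s2⟩ := hS w hw
      rw [hL] at hl
      rw [hG]
      have c1 := f3 w s1 hl
      have c2 := g3 w s2 hl
      rcases key v hv with k | ⟨h, k⟩
      · rw [(k w).1, (k w).2, c1]
      · rw [(k w).1, (k w).2, c1, c2]
  · rintro A ⟨hI, f1, f2, f3⟩
    have huA : u ∉ A := by
      intro h
      have h := f1 u ⟨hu, h⟩
      simp only [Set.mem_insert_iff, Set.mem_singleton_iff] at hlam h
      rcases hlam with h' | h' | h' <;> rw [h'] at h <;> simp at h
    have ho := odd_del_iff Γ.G u A huA {w : {x : V // x ≠ u} | (w : V) ∈ A} (fun _ => Iff.rfl)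
    refine ⟨fun v hv => hI v hv, ?_, ?_, ?_⟩
    · rintro w ⟨hw, hm⟩
      exact f1 w ⟨hw, hm⟩
    · rintro w ⟨hw, hm⟩
      exact f2 w ⟨hw, (ho w).1 hm⟩
    · intro w hw hl
      rw [hG, ho w]
      exact f3 w hw hl
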